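/- Let g ≥ 6 and let ε be a real number with 0 < ε ≤ (3γ − 2 − 1/g)/(1 + 3γ). Then every numerical semigroup S of genus g satisfying (γ − ε)·g < m(S) < (γ + ε)·g and (2 − ε)·γ·g < F(S) < (2 + ε)·γ·g has coprime nonzero left elements, i.e., gcd(L(S) \ {0}) = 1. In other words, B_g(ε) ⊆ S_g^{∞̄}. -/

import Mathlib

/-- A numerical semigroup: an additive submonoid of ℕ with finite complement. -/
structure NumericalSemigroup where
  carrier : Set ℕ
  zero_mem : 0 ∈ carrier
  add_mem : ∀ ⦃a b : ℕ⦄, a ∈ carrier → b ∈ carrier → a + b ∈ carrier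
  cofinite : (carrierᶜ : Set ℕ).Finite

namespace NumericalSemigroup

/-- The genus: the number of gaps. -/
noncomputable def genus (S : NumericalSemigroup) : ℕ := S.carrierᶜ.ncard

/-- The multiplicity: the smallest nonzero element. -/
noncomputable def multiplicity (S : NumericalSemigroup) : ℕ :=
  sInf {n : ℕ | n ∈ S.carrier ∧ n ≠ 0}

/-- The Frobenius number: the largest gap. -/
noncomputable def frobenius (S : NumericalSemigroup) : ℕ := sSup S.carrierᶜ

/-- The left elements: the elements of `S` smaller than the Frobenius number. -/
def leftElements (S : NumericalSemigroup) : Set ℕ :=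
  {s : ℕ | s ∈ S.carrier ∧ s < S.frobenius}

end NumericalSemigroup

/-- The gcd of a set of natural numbers: the common divisor that is divisible by
every common divisor (so `setGcd ∅ = 0`). -/
noncomputable def setGcd (A : Set ℕ) : ℕ :=
  sInf {d : ℕ | (∀ a ∈ A, d ∣ a) ∧ ∀ e : ℕ, (∀ a ∈ A, e ∣ a) → e ∣ d}

/-- The constant γ = (5 + √5)/10. -/
noncomputable def gamma : ℝ := (5 + Real.sqrt 5) / 10

/-- `S` belongs to an infinite chain in the semigroup tree. -/
def InInfiniteChain (S : NumericalSemigroup) : Prop :=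
  ∃ f : ℕ → NumericalSemigroup, f 0 = S ∧
    ∀ i : ℕ, (f (i + 1)).carrier ≠ Set.univ ∧
      (f i).carrier = (f (i + 1)).carrier ∪ {(f (i + 1)).frobenius}

theorem setGcd_eq_one {A : Set ℕ} (h : ∀ e : ℕ, (∀ a ∈ A, e ∣ a) → e = 1) : setGcd A = 1 := by
  have hset : {d : ℕ | (∀ a ∈ A, d ∣ a) ∧ ∀ e : ℕ, (∀ a ∈ A, e ∣ a) → e ∣ d} = {1} := by
    ext d
    simp only [Set.mem_ofPred_eq, Set.mem_singleton_iff]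
    refine ⟨fun hd => h d hd.1, ?_⟩
    rintro rfl
    exact ⟨fun a _ => one_dvd a, fun e he => (h e he).dvd⟩
  rw [setGcd, hset, csInf_singleton]

/-- A finite set of multiples of `e ≠ 1` has no two consecutive elements, so it fills at most
about half of any interval containing it. -/
theorem two_mul_card_le_of_dvd {e a b : ℕ} (he : e ≠ 1) {A : Finset ℕ}
    (hA : A ⊆ Finset.Ico a b) (hdvd : ∀ x ∈ A, e ∣ x) : 2 * A.card ≤ b + 1 - a := by
  have hdisj : Disjoint A (A.map (addRightEmbedding 1)) := by
    rw [Finset.disjoint_left]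
    intro x hx hx'
    obtain ⟨y, hy, rfl⟩ := Finset.mem_map.1 hx'
    exact he (Nat.dvd_one.1 ((Nat.dvd_add_right (hdvd y hy)).1 (hdvd _ hx)))
  have hsub : A.disjUnion _ hdisj ⊆ Finset.Ico a (b + 1) := by
    intro x hx
    rcases Finset.mem_disjUnion.1 hx with hx | hx
    · have := Finset.mem_Ico.1 (hA hx)
      exact Finset.mem_Ico.2 (by omega)
    · obtain ⟨y, hy, rfl⟩ := Finset.mem_map.1 hx
      have := Finset.mem_Ico.1 (hA hy)
      simp only [addRightEmbedding_apply, Finset.mem_Ico]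
      omega
  have hcard := Finset.card_le_card hsub
  rw [Finset.card_disjUnion, Finset.card_map, Nat.card_Ico] at hcard
  omega

namespace NumericalSemigroup

theorem frobenius_notMem (S : NumericalSemigroup) (h : S.genus ≠ 0) :
    S.frobenius ∉ S.carrier :=
  Nat.sSup_mem (Set.nonempty_of_ncard_ne_zero h) S.cofinite.bddAbove

theorem multiplicity_le (S : NumericalSemigroup) {n : ℕ} (hn : n ∈ S.carrier) (h0 : n ≠ 0) :
    S.multiplicity ≤ n :=
  Nat.sInf_le ⟨hn, h0⟩

open Classical in
theorem frobenius_le_genus_add_card (S : NumericalSemigroup) (h : S.genus ≠ 0) :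
    S.frobenius ≤
      S.genus + ((Finset.range S.frobenius).filter (· ∈ S.leftElements \ {0})).card := by
  set A := (Finset.range S.frobenius).filter (· ∈ S.leftElements \ {0})
  have hsub : Finset.Icc 1 S.frobenius ⊆ S.cofinite.toFinset ∪ A := by
    intro n hn
    rw [Finset.mem_Icc] at hn
    by_cases hnS : n ∈ S.carrier
    · have hne : n ≠ S.frobenius := fun h' => S.frobenius_notMem h (h' ▸ hnS)
      have hlt : n < S.frobenius := by omega
      exact Finset.mem_union_right _ (Finset.mem_filter.2
        ⟨Finset.mem_range.2 hlt, ⟨hnS, hlt⟩, Nat.one_le_iff_ne_zero.1 hn.1⟩)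
    · exact Finset.mem_union_left _ (S.cofinite.mem_toFinset.2 hnS)
  have hcard := (Finset.card_le_card hsub).trans (Finset.card_union_le _ _)
  rwa [Nat.card_Icc, Nat.add_sub_cancel, ← Set.ncard_eq_toFinset_card _ S.cofinite] at hcard

open Classical in
/-- If the nonzero left elements have a common divisor other than `1` and the multiplicity is
at most the Frobenius number, then `F + m ≤ 2g + 1`. -/
theorem frobenius_add_multiplicity_le (S : NumericalSemigroup) (h : S.genus ≠ 0)
    (hmF : S.multiplicity ≤ S.frobenius) {e : ℕ} (he : e ≠ 1)
    (hdvd : ∀ a ∈ S.leftElements \ {0}, e ∣ a) :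
    S.frobenius + S.multiplicity ≤ 2 * S.genus + 1 := by
  have hlower := S.frobenius_le_genus_add_card h
  have hupper : 2 * ((Finset.range S.frobenius).filter (· ∈ S.leftElements \ {0})).card ≤
      S.frobenius + 1 - S.multiplicity := by
    refine two_mul_card_le_of_dvd he (fun x hx => ?_) fun x hx => hdvd x (Finset.mem_filter.1 hx).2
    obtain ⟨hlt, hL, h0⟩ := Finset.mem_filter.1 hx
    exact Finset.mem_Ico.2 ⟨S.multiplicity_le hL.1 h0, Finset.mem_range.1 hlt⟩
  omega

end NumericalSemigroup

theorem B_subset_coprime (g : ℕ) (hg : 6 ≤ g) (ε : ℝ) (hε : 0 < ε)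
    (hε' : ε ≤ (3 * gamma - 2 - 1 / (g : ℝ)) / (1 + 3 * gamma))
    (S : NumericalSemigroup) (hgen : S.genus = g)
    (hm : (gamma - ε) * g < (S.multiplicity : ℝ) ∧ (S.multiplicity : ℝ) < (gamma + ε) * g)
    (hF : (2 - ε) * gamma * g < (S.frobenius : ℝ) ∧ (S.frobenius : ℝ) < (2 + ε) * gamma * g) :
    setGcd (S.leftElements \ {0}) = 1 := by
  have hg0 : (0 : ℝ) < g := by exact_mod_cast (by omega : 0 < g)
  have hγ : 0 < gamma := by unfold gamma; positivity
  have hγ1 : gamma < 1 := by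
    have : Real.sqrt 5 < 5 := by rw [Real.sqrt_lt' (by norm_num)]; norm_num
    unfold gamma; linarith
  have hginv : 0 < 1 / (g : ℝ) := by positivity
  rw [le_div_iff₀ (by positivity)] at hε'
  have hεγ : 0 < ε * gamma := mul_pos hε hγ
  have hmF : S.multiplicity ≤ S.frobenius := by
    have hcoef : (gamma + ε) * g ≤ (2 - ε) * gamma * g :=
      mul_le_mul_of_nonneg_right (by nlinarith) hg0.le
    exact_mod_cast (hm.2.trans_le hcoef |>.trans hF.1).le
  refine setGcd_eq_one fun e hdvd => ?_
  by_contra he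
  have hle := S.frobenius_add_multiplicity_le (by omega) hmF he hdvd
  rw [hgen] at hle
  have hle' : (S.frobenius : ℝ) + S.multiplicity ≤ 2 * g + 1 := by exact_mod_cast hle
  have hcoef : (2 + 1 / (g : ℝ)) * g ≤ ((2 - ε) * gamma + (gamma - ε)) * g :=
    mul_le_mul_of_nonneg_right (by linarith) hg0.le
  rw [add_mul, one_div_mul_cancel hg0.ne'] at hcoef
  linarith [hm.1, hF.1]
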